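/- arXiv:1312.7690 — 2 statements merged into one kernel-verified Lean document; each statement's English description precedes it below -/
import Mathlib

section
/- Let V be a complex vector space and let J : V \otimes V \to V \otimes V be a linear map satisfying J \circ J = -id and J^{12} \circ J^{23} = J^{23} \circ J^{12} on V \otimes V \otimes V, where J^{12} acts as J on the first two tensor factors and as the identity on the third, and J^{23} acts as the identity on the first factor and as J on the last two. Define R(x) = (\cos x) \cdot id + (\sin x) \cdot J for real x. Then R satisfies the colored Yang-Baxter equation: for all real x, y, R^{12}(x) \circ R^{23}(x+y) \circ R^{12}(y) = R^{23}(y) \circ R^{12}(x+y) \circ R^{23}(x), where R^{12}(t) and R^{23}(t) are defined from R(t) in the same way as J^{12}, J^{23} are defined from J. -/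
open TensorProduct

/-- Extension of an endomorphism of `V ⊗ V` acting on the first two factors of
`(V ⊗ V) ⊗ V` (and as the identity on the third). -/
noncomputable def ext12 {V : Type*} [AddCommGroup V] [Module ℂ V]
    (T : V ⊗[ℂ] V →ₗ[ℂ] V ⊗[ℂ] V) :
    (V ⊗[ℂ] V) ⊗[ℂ] V →ₗ[ℂ] (V ⊗[ℂ] V) ⊗[ℂ] V :=
  TensorProduct.map T LinearMap.id

/-- Extension of an endomorphism of `V ⊗ V` acting on the last two factors of
`(V ⊗ V) ⊗ V` (and as the identity on the first), transported along the associator. -/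
noncomputable def ext23 {V : Type*} [AddCommGroup V] [Module ℂ V]
    (T : V ⊗[ℂ] V →ₗ[ℂ] V ⊗[ℂ] V) :
    (V ⊗[ℂ] V) ⊗[ℂ] V →ₗ[ℂ] (V ⊗[ℂ] V) ⊗[ℂ] V :=
  (TensorProduct.assoc ℂ V V V).symm.toLinearMap ∘ₗ
    TensorProduct.map LinearMap.id T ∘ₗ (TensorProduct.assoc ℂ V V V).toLinearMap

/-- `R(x) = (cos x) • id + (sin x) • J`. -/
noncomputable def Rop {V : Type*} [AddCommGroup V] [Module ℂ V]
    (J : V ⊗[ℂ] V →ₗ[ℂ] V ⊗[ℂ] V) (x : ℝ) : V ⊗[ℂ] V →ₗ[ℂ] V ⊗[ℂ] V :=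
  (Real.cos x : ℂ) • LinearMap.id + (Real.sin x : ℂ) • J

section YangBaxter

variable {V : Type*} [AddCommGroup V] [Module ℂ V]

theorem ext12_comp (S T : V ⊗[ℂ] V →ₗ[ℂ] V ⊗[ℂ] V) :
    ext12 (S ∘ₗ T) = ext12 S ∘ₗ ext12 T := by
  simp only [ext12, ← TensorProduct.map_comp, LinearMap.id_comp]

theorem ext23_comp (S T : V ⊗[ℂ] V →ₗ[ℂ] V ⊗[ℂ] V) :
    ext23 (S ∘ₗ T) = ext23 S ∘ₗ ext23 T := by
  have h : TensorProduct.map (LinearMap.id : V →ₗ[ℂ] V) (S ∘ₗ T) =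
      TensorProduct.map LinearMap.id S ∘ₗ TensorProduct.map LinearMap.id T := by
    rw [← TensorProduct.map_comp, LinearMap.id_comp]
  ext1
  simp [ext23, h, LinearMap.comp_assoc]

theorem ext12_Rop (J : V ⊗[ℂ] V →ₗ[ℂ] V ⊗[ℂ] V) (x : ℝ) :
    ext12 (Rop J x) = (Real.cos x : ℂ) • LinearMap.id + (Real.sin x : ℂ) • ext12 J := by
  simp only [ext12, Rop, TensorProduct.map_add_left, TensorProduct.map_smul_left,
    TensorProduct.map_id]

theorem ext23_Rop (J : V ⊗[ℂ] V →ₗ[ℂ] V ⊗[ℂ] V) (x : ℝ) :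
    ext23 (Rop J x) = (Real.cos x : ℂ) • LinearMap.id + (Real.sin x : ℂ) • ext23 J := by
  simp only [ext23, Rop, TensorProduct.map_add_right, TensorProduct.map_smul_right,
    TensorProduct.map_id, LinearMap.add_comp, LinearMap.comp_add, LinearMap.smul_comp,
    LinearMap.comp_smul, LinearMap.id_comp, LinearEquiv.symm_comp]

theorem Rop_comp_Rop {J : V ⊗[ℂ] V →ₗ[ℂ] V ⊗[ℂ] V} (hJJ : J ∘ₗ J = -LinearMap.id)
    (x y : ℝ) : Rop J x ∘ₗ Rop J y = Rop J (x + y) := by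
  simp only [Rop, LinearMap.add_comp, LinearMap.comp_add, LinearMap.smul_comp,
    LinearMap.comp_smul, LinearMap.id_comp, LinearMap.comp_id, hJJ, Real.cos_add,
    Real.sin_add, Complex.ofReal_add, Complex.ofReal_sub, Complex.ofReal_mul]
  module

theorem ext12_Rop_comp_ext23_Rop {J : V ⊗[ℂ] V →ₗ[ℂ] V ⊗[ℂ] V}
    (hcomm : ext12 J ∘ₗ ext23 J = ext23 J ∘ₗ ext12 J) (x y : ℝ) :
    ext12 (Rop J x) ∘ₗ ext23 (Rop J y) = ext23 (Rop J y) ∘ₗ ext12 (Rop J x) := by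
  simp only [ext12_Rop, ext23_Rop, LinearMap.add_comp, LinearMap.comp_add,
    LinearMap.smul_comp, LinearMap.comp_smul, LinearMap.id_comp, LinearMap.comp_id, hcomm]
  module

end YangBaxter

theorem stmt_12 {V : Type*} [AddCommGroup V] [Module ℂ V]
    (J : V ⊗[ℂ] V →ₗ[ℂ] V ⊗[ℂ] V)
    (hJJ : J ∘ₗ J = -LinearMap.id)
    (hcomm : ext12 J ∘ₗ ext23 J = ext23 J ∘ₗ ext12 J) :
    ∀ x y : ℝ,
      ext12 (Rop J x) ∘ₗ ext23 (Rop J (x + y)) ∘ₗ ext12 (Rop J y) =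
        ext23 (Rop J y) ∘ₗ ext12 (Rop J (x + y)) ∘ₗ ext23 (Rop J x) := by
  intro x y
  rw [← ext12_Rop_comp_ext23_Rop hcomm y (x + y), ← LinearMap.comp_assoc, ← ext12_comp,
    Rop_comp_Rop hJJ, ext12_Rop_comp_ext23_Rop hcomm (x + y) x, ← LinearMap.comp_assoc,
    ← ext23_comp, Rop_comp_Rop hJJ, add_comm y x, ext12_Rop_comp_ext23_Rop hcomm]
end

section
/- Let \alpha be a nonzero complex number and, for real x, let R(x) be the 4\times 4 complex matrix with diagonal entries all \cos x, antidiagonal entries R(x)_{14} = (i/\alpha)\sin x, R(x)_{23} = i \sin x, R(x)_{32} = i \sin x, R(x)_{41} = \alpha i \sin x, and all other entries zero. Then R satisfies the colored Yang-Baxter equation in matrix form: for all real x, y, (R(x) \otimes I_2)(I_2 \otimes R(x+y))(R(y) \otimes I_2) = (I_2 \otimes R(y))(R(x+y) \otimes I_2)(I_2 \otimes R(x)), where \otimes is the Kronecker product. -/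
open Matrix Kronecker

/-- Reindexing of the Kronecker product `T ⊗ I₂` of a `4 × 4` complex matrix with the
`2 × 2` identity, as an `8 × 8` matrix. -/
noncomputable def mat12 (T : Matrix (Fin 4) (Fin 4) ℂ) : Matrix (Fin 8) (Fin 8) ℂ :=
  Matrix.reindex finProdFinEquiv finProdFinEquiv (T ⊗ₖ (1 : Matrix (Fin 2) (Fin 2) ℂ))

/-- Reindexing of the Kronecker product `I₂ ⊗ T` of the `2 × 2` identity with a
`4 × 4` complex matrix, as an `8 × 8` matrix. -/
noncomputable def mat23 (T : Matrix (Fin 4) (Fin 4) ℂ) : Matrix (Fin 8) (Fin 8) ℂ :=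
  Matrix.reindex finProdFinEquiv finProdFinEquiv ((1 : Matrix (Fin 2) (Fin 2) ℂ) ⊗ₖ T)

/-- The `4 × 4` colored `R`-matrix with diagonal entries `cos x` and antidiagonal
entries `(i/α) sin x`, `i sin x`, `i sin x`, `α i sin x`. -/
noncomputable def Rmat (α : ℂ) (x : ℝ) : Matrix (Fin 4) (Fin 4) ℂ :=
  !![(Real.cos x : ℂ), 0, 0, (Complex.I / α) * (Real.sin x : ℂ);
     0, (Real.cos x : ℂ), Complex.I * (Real.sin x : ℂ), 0;
     0, Complex.I * (Real.sin x : ℂ), (Real.cos x : ℂ), 0;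
     α * Complex.I * (Real.sin x : ℂ), 0, 0, (Real.cos x : ℂ)]

lemma mat12_mul (S T : Matrix (Fin 4) (Fin 4) ℂ) : mat12 (S * T) = mat12 S * mat12 T := by
  simp only [mat12, reindex_apply]
  rw [submatrix_mul_equiv, ← mul_kronecker_mul, one_mul]

lemma mat23_mul (S T : Matrix (Fin 4) (Fin 4) ℂ) : mat23 (S * T) = mat23 S * mat23 T := by
  simp only [mat23, reindex_apply]
  rw [submatrix_mul_equiv, ← mul_kronecker_mul, one_mul]

lemma Rmat_add {α : ℂ} (hα : α ≠ 0) (x y : ℝ) : Rmat α (x + y) = Rmat α x * Rmat α y := by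
  ext i j
  fin_cases i <;> fin_cases j <;>
    simp [Rmat, mul_apply, Fin.sum_univ_four, Complex.cos_add, Complex.sin_add] <;>
    field_simp <;> grind [Complex.I_sq]

lemma commute_mat12_mat23_Rmat {α : ℂ} (hα : α ≠ 0) (x y : ℝ) :
    Commute (mat12 (Rmat α x)) (mat23 (Rmat α y)) := by
  ext i j
  fin_cases i <;> fin_cases j <;>
    simp [mat12, mat23, Rmat, mul_apply, Fin.sum_univ_eight, finProdFinEquiv, Fin.divNat,
      Fin.modNat, one_apply] <;>
    field_simp

theorem stmt_15 (α : ℂ) (hα : α ≠ 0) :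
    ∀ x y : ℝ,
      mat12 (Rmat α x) * mat23 (Rmat α (x + y)) * mat12 (Rmat α y) =
        mat23 (Rmat α y) * mat12 (Rmat α (x + y)) * mat23 (Rmat α x) := by
  intro x y
  rw [(commute_mat12_mat23_Rmat hα x (x + y)).eq, mul_assoc, ← mat12_mul, ← Rmat_add hα,
    ← (commute_mat12_mat23_Rmat hα (x + y) y).eq, mul_assoc, ← mat23_mul, ← Rmat_add hα,
    add_comm y x, (commute_mat12_mat23_Rmat hα (x + y) (x + y)).eq]
end
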